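/- Let $W_k$ be an $(n-1) \times (n-1)$ Hermitian matrix, $a \in \mathbb{C}^{n-1}$, and $z = x + i\eta$ with $\eta > 0$. Then $\left|\frac{1 + a^*(W_k - zI)^{-2} a}{w - z - a^*(W_k - zI)^{-1}a}\right| \le \frac{1}{\eta}$ for any real $w$. -/

import Mathlib

open Matrix

lemma aux_self {n : ℕ} (v : Fin n → ℂ) :
    star v ⬝ᵥ v = ((∑ i, ‖v i‖ ^ 2 : ℝ) : ℂ) := by
  simp only [dotProduct, Pi.star_apply, Complex.ofReal_sum]
  refine Finset.sum_congr rfl fun i _ => ?_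
  rw [Complex.star_def, Complex.conj_mul']
  simp

lemma aux_cs {n : ℕ} (c b : Fin n → ℂ) :
    ‖star c ⬝ᵥ b‖ ≤ ((∑ i, ‖c i‖ ^ 2) + ∑ i, ‖b i‖ ^ 2) / 2 := by
  rw [← Finset.sum_add_distrib, Finset.sum_div]
  refine (norm_sum_le _ _).trans (Finset.sum_le_sum fun i _ => ?_)
  rw [norm_mul, Pi.star_apply, norm_star]
  nlinarith [sq_nonneg (‖c i‖ - ‖b i‖)]

lemma aux_im {n : ℕ} (W : Matrix (Fin n) (Fin n) ℂ) (hW : W.IsHermitian) (v : Fin n → ℂ)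
    (z : ℂ) : (star v ⬝ᵥ ((W - z • 1) *ᵥ v)).im = - z.im * ∑ i, ‖v i‖ ^ 2 := by
  have h : (star v ⬝ᵥ (W *ᵥ v)).im = 0 := hW.im_star_dotProduct_mulVec_self v
  rw [sub_mulVec, dotProduct_sub, smul_mulVec, one_mulVec, dotProduct_smul, aux_self,
    Complex.sub_im, h, smul_eq_mul, Complex.im_mul_ofReal]
  ring

/-- Resolvent derivative bound (Bai–Silverstein, Theorem A.6). -/
theorem resolvent_derivative_quotient_bound (n : ℕ)
    (Wk : Matrix (Fin n) (Fin n) ℂ) (hWk : Wk.IsHermitian)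
    (a : Fin n → ℂ) (x η : ℝ) (hη : 0 < η) (z : ℂ) (hz : z = x + η * Complex.I)
    (w : ℝ) :
    ‖(1 + star a ⬝ᵥ (((Wk - z • 1)⁻¹ ^ 2) *ᵥ a))
        / ((w : ℂ) - z - star a ⬝ᵥ ((Wk - z • 1)⁻¹ *ᵥ a))‖ ≤ 1 / η := by
  have hzi : z.im = η := by simp [hz]
  have him := fun v => aux_im Wk hWk v z
  have hAH : (Wk - z • 1)ᴴ = Wk - star z • 1 := by
    rw [conjTranspose_sub, hWk.eq, conjTranspose_smul, conjTranspose_one]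
  have hcomm : (Wk - z • 1) * (Wk - z • 1)ᴴ = (Wk - z • 1)ᴴ * (Wk - z • 1) := by
    rw [hAH]
    simp only [sub_mul, mul_sub, smul_mul_assoc, mul_smul_comm, one_mul, mul_one,
      smul_sub]
    rw [smul_comm z (star z)]
    abel
  generalize (Wk - z • 1) = A at *
  have hdet : IsUnit A.det := by
    rw [isUnit_iff_ne_zero]
    intro h0
    obtain ⟨v, hv, hv0⟩ := Matrix.exists_mulVec_eq_zero_iff.mpr h0
    have h := him v
    rw [hv0, hzi] at h
    simp only [dotProduct_zero, Complex.zero_im] at h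
    have hs : ∑ i, ‖v i‖ ^ 2 = 0 := by
      rcases mul_eq_zero.mp h.symm with h | h
      · linarith
      · exact h
    apply hv
    funext i
    have := (Finset.sum_eq_zero_iff_of_nonneg (fun i _ => by positivity)).mp hs i
      (Finset.mem_univ i)
    simpa using this
  set b := A⁻¹ *ᵥ a with hb
  set c := (A⁻¹)ᴴ *ᵥ a with hc
  have hab : A *ᵥ b = a := by
    rw [hb, mulVec_mulVec, mul_nonsing_inv _ hdet, one_mulVec]
  have hRR : A⁻¹ * (A⁻¹)ᴴ = (A⁻¹)ᴴ * A⁻¹ := by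
    rw [conjTranspose_nonsing_inv, ← Matrix.mul_inv_rev, ← Matrix.mul_inv_rev, hcomm]
  have hcb : ∑ i, ‖c i‖ ^ 2 = ∑ i, ‖b i‖ ^ 2 := by
    have : star c ⬝ᵥ c = star b ⬝ᵥ b := by
      rw [hb, hc, star_mulVec, star_mulVec, conjTranspose_conjTranspose,
        ← dotProduct_mulVec, ← dotProduct_mulVec, mulVec_mulVec, mulVec_mulVec, hRR]
    rw [aux_self, aux_self] at this
    exact_mod_cast this
  have hnum : star a ⬝ᵥ ((A⁻¹ ^ 2) *ᵥ a) = star c ⬝ᵥ b := by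
    rw [hc, star_mulVec, conjTranspose_conjTranspose, ← dotProduct_mulVec, hb, mulVec_mulVec,
      pow_two]
  have hden : (star a ⬝ᵥ b).im = η * ∑ i, ‖b i‖ ^ 2 := by
    have h1 : star a ⬝ᵥ b = star (star b ⬝ᵥ (A *ᵥ b)) := by
      rw [hab, star_dotProduct]
    rw [h1, Complex.star_def, Complex.conj_im, him, hzi]
    ring
  set S := ∑ i, ‖b i‖ ^ 2 with hS
  have hS0 : 0 ≤ S := Finset.sum_nonneg fun i _ => by positivity
  rw [hnum, norm_div]
  have hN : ‖1 + star c ⬝ᵥ b‖ ≤ 1 + S := by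
    refine (norm_add_le _ _).trans ?_
    have := aux_cs c b
    rw [hcb] at this
    simp only [norm_one]
    linarith
  have hD : η * (1 + S) ≤ ‖(w : ℂ) - z - star a ⬝ᵥ b‖ := by
    refine le_trans ?_ (Complex.abs_im_le_norm _)
    simp only [Complex.sub_im, Complex.ofReal_im, hzi, hden]
    rw [← abs_neg]
    refine le_trans (le_of_eq ?_) (le_abs_self _)
    ring
  rw [div_le_div_iff₀ (lt_of_lt_of_le (by positivity) hD) hη]
  nlinarith
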